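/- arXiv:2510.02111 — 3 statements merged into one kernel-verified Lean document; each statement's English description precedes it below -/
import Mathlib

section
/- Let S be an equidistributed sequence in base b = (b_1,…,b_d) and write G_{u,k}(n) for the gain coefficient of its first n points. For every nonempty u ⊆ {1,…,d}, every k ∈ ℕ_0^{|u|}, and every n ∈ ℕ, G_{u,k}( n · ∏_{j∈u} b_j^{k_j} ) = G_{u,0}(n), where 0 denotes the all-zero multi-index on u. -/
open Finset MeasureTheory

noncomputable section


/-- `S` is an equidistributed sequence in base `b`: every point lies in `[0,1)^d` and,
for all `r` and resolutions `k`, every elementary `k`-interval in base `b` contains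
exactly one of the points `x_{rB}, …, x_{(r+1)B-1}` where `B = ∏ j, b j ^ k j`. -/
def IsEquidistributed {d : ℕ} (b : Fin d → ℕ) (S : ℕ → Fin d → ℝ) : Prop :=
  (∀ i j, S i j ∈ Set.Ico (0 : ℝ) 1) ∧
  ∀ (r : ℕ) (k : Fin d → ℕ) (a : Fin d → ℤ),
    (∀ j, 0 ≤ a j ∧ a j < (b j : ℤ) ^ k j) →
    ∃! i, i ∈ Finset.Ico (r * ∏ j, b j ^ k j) ((r + 1) * ∏ j, b j ^ k j) ∧
      ∀ j, ⌊(b j : ℝ) ^ k j * S i j⌋ = a j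

/-- `m_{u,v,k} = ∏_{j∈v} b_j^{k_j+1} ∏_{j∈u∖v} b_j^{k_j}`. -/
def mq {d : ℕ} (b : Fin d → ℕ) (u v : Finset (Fin d)) (k : Fin d → ℕ) : ℕ :=
  (∏ j ∈ v, b j ^ (k j + 1)) * ∏ j ∈ u \ v, b j ^ k j

/-- `C_{u,v,k}(P_n)`: number of ordered pairs of the first `n` points of `S` lying in the
same elementary interval of resolution `k_j + χ(j∈v)` in coordinate `j ∈ u`. -/
def Cq {d : ℕ} (b : Fin d → ℕ) (S : ℕ → Fin d → ℝ) (u v : Finset (Fin d))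
    (k : Fin d → ℕ) (n : ℕ) : ℕ :=
  ∑ i ∈ Finset.range n, ∑ i' ∈ Finset.range n,
    if ∀ j ∈ u, ⌊(b j : ℝ) ^ (k j + if j ∈ v then 1 else 0) * S i j⌋
        = ⌊(b j : ℝ) ^ (k j + if j ∈ v then 1 else 0) * S i' j⌋ then 1 else 0

/-- The gain coefficient `G_{u,k}(P_n)` of the first `n` points of `S` in base `b`. -/
def gain {d : ℕ} (b : Fin d → ℕ) (S : ℕ → Fin d → ℝ) (u : Finset (Fin d))
    (k : Fin d → ℕ) (n : ℕ) : ℝ :=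
  (∏ j ∈ u, ((b j : ℝ) - 1)⁻¹) * (n : ℝ)⁻¹ *
    ∑ i ∈ Finset.range n, ∑ i' ∈ Finset.range n,
      ∏ j ∈ u,
        ((b j : ℝ) *
            (if ⌊(b j : ℝ) ^ (k j + 1) * S i j⌋ = ⌊(b j : ℝ) ^ (k j + 1) * S i' j⌋
              then 1 else 0) -
          (if ⌊(b j : ℝ) ^ k j * S i j⌋ = ⌊(b j : ℝ) ^ k j * S i' j⌋ then 1 else 0))

/-- If every block `[rM, (r+1)M)` meets every class of `c` exactly once, then every class meets
`[0, qM)` exactly `q` times. -/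
theorem sum_range_mul_ite_eq {α : Type*} [DecidableEq α] (c : ℕ → α) (M : ℕ)
    (h : ∀ r i, ∃! i', i' ∈ Finset.Ico (r * M) ((r + 1) * M) ∧ c i' = c i) (q i : ℕ) :
    ∑ i' ∈ Finset.range (q * M), (if c i = c i' then 1 else 0) = q := by
  induction q with
  | zero => simp
  | succ q ih =>
    rw [← Finset.sum_range_add_sum_Ico _ (Nat.mul_le_mul_right M (Nat.le_succ q)), ih]
    congr 1
    obtain ⟨a, ⟨ha, hca⟩, huniq⟩ := h q i
    rw [Finset.sum_eq_single_of_mem a ha, if_pos hca.symm]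
    intro x hx hxa
    exact if_neg fun hcx => hxa (huniq x ⟨hx, hcx.symm⟩)

/-- If every block `[rM, (r+1)M)` meets every class of `c` exactly once, then the number of pairs
of indices below `qM + r`, where `r ≤ M`, lying in a common class is `q²M + 2qr + r`. -/
theorem sum_sum_ite_eq_of_blocks {α : Type*} [DecidableEq α] (c : ℕ → α) (M : ℕ)
    (h : ∀ r i, ∃! i', i' ∈ Finset.Ico (r * M) ((r + 1) * M) ∧ c i' = c i) (q r : ℕ)
    (hr : r ≤ M) :
    ∑ i ∈ Finset.range (q * M + r), ∑ i' ∈ Finset.range (q * M + r),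
      (if c i = c i' then 1 else 0) = q ^ 2 * M + 2 * q * r + r := by
  have hle : q * M ≤ q * M + r := Nat.le_add_right _ _
  have htail : ∀ i ∈ Finset.Ico (q * M) (q * M + r),
      ∑ i' ∈ Finset.Ico (q * M) (q * M + r), (if c i = c i' then 1 else 0) = 1 := by
    intro i hi
    have hsub : ∀ x ∈ Finset.Ico (q * M) (q * M + r),
        x ∈ Finset.Ico (q * M) ((q + 1) * M) := by
      intro x hx
      rw [Finset.mem_Ico] at hx ⊢
      exact ⟨hx.1, by linarith [hx.2]⟩
    rw [Finset.sum_eq_single_of_mem i hi, if_pos rfl]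
    intro x hx hxi
    exact if_neg fun hcx => hxi ((h q i).unique ⟨hsub x hx, hcx.symm⟩ ⟨hsub i hi, rfl⟩)
  have hcross : ∑ i ∈ Finset.range (q * M), ∑ i' ∈ Finset.Ico (q * M) (q * M + r),
      (if c i = c i' then 1 else 0) = r * q := by
    rw [Finset.sum_comm, Finset.sum_congr rfl fun i _ => (Finset.sum_congr rfl fun i' _ =>
      if_congr eq_comm rfl rfl).trans (sum_range_mul_ite_eq c M h q i)]
    simp
  simp_rw [← Finset.sum_range_add_sum_Ico _ hle, Finset.sum_add_distrib,
    sum_range_mul_ite_eq c M h, hcross]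
  rw [Finset.sum_congr rfl htail]
  simp only [Finset.sum_const, Finset.card_range, Nat.card_Ico, smul_eq_mul,
    Nat.add_sub_cancel_left]
  ring

/-- Every block of `∏ j ∈ u, b j ^ l j` points of an equidistributed sequence meets the elementary
interval of any given point exactly once, the interval having resolution `l` on `u` and `0`
elsewhere. -/
theorem IsEquidistributed.existsUnique_block {d : ℕ} {b : Fin d → ℕ} (hb : ∀ j, 0 < b j)
    {S : ℕ → Fin d → ℝ} (hS : IsEquidistributed b S) (u : Finset (Fin d)) (l : Fin d → ℕ)
    (r i : ℕ) :
    ∃! i', i' ∈ Finset.Ico (r * ∏ j ∈ u, b j ^ l j) ((r + 1) * ∏ j ∈ u, b j ^ l j) ∧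
      (fun j : u => ⌊(b j : ℝ) ^ l j * S i' j⌋) = fun j : u => ⌊(b j : ℝ) ^ l j * S i j⌋ := by
  set m : Fin d → ℕ := fun j => if j ∈ u then l j else 0 with hm
  have hprod : ∏ j, b j ^ m j = ∏ j ∈ u, b j ^ l j := by
    simp [hm, pow_ite, Finset.prod_ite_mem]
  have hcell : ∀ i', (∀ j, ⌊(b j : ℝ) ^ m j * S i' j⌋ = ⌊(b j : ℝ) ^ m j * S i j⌋) ↔
      (fun j : u => ⌊(b j : ℝ) ^ l j * S i' j⌋) = fun j : u => ⌊(b j : ℝ) ^ l j * S i j⌋ := by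
    intro i'
    rw [funext_iff]
    constructor
    · intro h j
      simpa [hm] using h j
    · intro h j
      by_cases hj : j ∈ u
      · simpa [hm, hj] using h ⟨j, hj⟩
      · have hz : ∀ i, ⌊S i j⌋ = 0 := fun i => Int.floor_eq_zero_iff.2 (hS.1 i j)
        simp [hm, hj, hz]
  have key := hS.2 r m (fun j => ⌊(b j : ℝ) ^ m j * S i j⌋) fun j => by
    have hpos : (0 : ℝ) < (b j : ℝ) ^ m j := pow_pos (Nat.cast_pos.2 (hb j)) _
    refine ⟨Int.floor_nonneg.2 (mul_nonneg hpos.le (hS.1 i j).1), Int.floor_lt.2 ?_⟩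
    push_cast
    exact mul_lt_of_lt_one_right hpos (hS.1 i j).2
  simpa only [hprod, hcell] using key

/-- The pair counts of an equidistributed sequence. -/
theorem Cq_mul_prod_add {d : ℕ} {b : Fin d → ℕ} (hb : ∀ j, 0 < b j) {S : ℕ → Fin d → ℝ}
    (hS : IsEquidistributed b S) (u v : Finset (Fin d)) (k : Fin d → ℕ) (q r : ℕ)
    (hr : r ≤ ∏ j ∈ u, b j ^ (k j + if j ∈ v then 1 else 0)) :
    Cq b S u v k (q * (∏ j ∈ u, b j ^ (k j + if j ∈ v then 1 else 0)) + r) =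
      q ^ 2 * (∏ j ∈ u, b j ^ (k j + if j ∈ v then 1 else 0)) + 2 * q * r + r := by
  rw [← sum_sum_ite_eq_of_blocks _ _
    (hS.existsUnique_block hb u fun j => k j + if j ∈ v then 1 else 0) q r hr]
  simp [Cq, funext_iff]

/-- Refining the resolution by `k` and multiplying the number of points accordingly multiplies the
pair count by `∏ j ∈ u, b j ^ k j`. -/
theorem Cq_mul_prod {d : ℕ} {b : Fin d → ℕ} (hb : ∀ j, 0 < b j) {S : ℕ → Fin d → ℝ}
    (hS : IsEquidistributed b S) (u v : Finset (Fin d)) (k : Fin d → ℕ) (n : ℕ) :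
    Cq b S u v k (n * ∏ j ∈ u, b j ^ k j) =
      (∏ j ∈ u, b j ^ k j) * Cq b S u v (fun _ => 0) n := by
  set B := ∏ j ∈ u, b j ^ k j
  set m := ∏ j ∈ u, b j ^ (0 + if j ∈ v then 1 else 0) with hm
  have hmB : ∏ j ∈ u, b j ^ (k j + if j ∈ v then 1 else 0) = m * B := by
    simp only [hm, B, ← Finset.prod_mul_distrib, ← pow_add, zero_add, add_comm]
  have hmpos : 0 < m := Finset.prod_pos fun j _ => pow_pos (hb j) _
  have hlt : n % m ≤ m := (Nat.mod_lt n hmpos).le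
  have hn : n = n / m * m + n % m := (Nat.div_add_mod' n m).symm
  have h₀ := Cq_mul_prod_add hb hS u v (fun _ => 0) (n / m) (n % m) hlt
  have h₁ := Cq_mul_prod_add hb hS u v k (n / m) (n % m * B)
    (hmB ▸ Nat.mul_le_mul_right B hlt)
  rw [← hm, ← hn] at h₀
  rw [hmB, ← mul_assoc, ← add_mul, ← hn] at h₁
  rw [h₀, h₁]
  ring

/-- The gain coefficient as a signed combination of pair counts. -/
theorem gain_eq_sum_Cq {d : ℕ} (b : Fin d → ℕ) (S : ℕ → Fin d → ℝ) (u : Finset (Fin d))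
    (k : Fin d → ℕ) (n : ℕ) :
    gain b S u k n = (∏ j ∈ u, ((b j : ℝ) - 1)⁻¹) * (n : ℝ)⁻¹ *
      ∑ v ∈ u.powerset, ((∏ j ∈ v, (b j : ℝ)) * (-1) ^ (u \ v).card) * (Cq b S u v k n : ℝ) := by
  have hterm : ∀ i i', ∏ j ∈ u,
        ((b j : ℝ) *
            (if ⌊(b j : ℝ) ^ (k j + 1) * S i j⌋ = ⌊(b j : ℝ) ^ (k j + 1) * S i' j⌋
              then 1 else 0) -
          (if ⌊(b j : ℝ) ^ k j * S i j⌋ = ⌊(b j : ℝ) ^ k j * S i' j⌋ then 1 else 0)) =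
      ∑ v ∈ u.powerset, ((∏ j ∈ v, (b j : ℝ)) * (-1) ^ (u \ v).card) *
        if ∀ j ∈ u, ⌊(b j : ℝ) ^ (k j + if j ∈ v then 1 else 0) * S i j⌋
          = ⌊(b j : ℝ) ^ (k j + if j ∈ v then 1 else 0) * S i' j⌋ then 1 else 0 := by
    intro i i'
    simp_rw [sub_eq_add_neg]
    rw [Finset.prod_add]
    refine Finset.sum_congr rfl fun v hv => ?_
    have hbool : (if ∀ j ∈ u, ⌊(b j : ℝ) ^ (k j + if j ∈ v then 1 else 0) * S i j⌋
          = ⌊(b j : ℝ) ^ (k j + if j ∈ v then 1 else 0) * S i' j⌋ then (1 : ℝ) else 0) =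
        ∏ j ∈ u, if ⌊(b j : ℝ) ^ (k j + if j ∈ v then 1 else 0) * S i j⌋
          = ⌊(b j : ℝ) ^ (k j + if j ∈ v then 1 else 0) * S i' j⌋ then 1 else 0 := by
      rw [Finset.prod_boole]
      congr
    have hout : ∏ j ∈ u \ v, (if ⌊(b j : ℝ) ^ (k j + if j ∈ v then 1 else 0) * S i j⌋
          = ⌊(b j : ℝ) ^ (k j + if j ∈ v then 1 else 0) * S i' j⌋ then (1 : ℝ) else 0) =
        ∏ j ∈ u \ v, if ⌊(b j : ℝ) ^ k j * S i j⌋ = ⌊(b j : ℝ) ^ k j * S i' j⌋ then 1 else 0 :=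
      Finset.prod_congr rfl fun j hj => by rw [if_neg (Finset.mem_sdiff.1 hj).2, add_zero]
    have hin : ∏ j ∈ v, (if ⌊(b j : ℝ) ^ (k j + if j ∈ v then 1 else 0) * S i j⌋
          = ⌊(b j : ℝ) ^ (k j + if j ∈ v then 1 else 0) * S i' j⌋ then (1 : ℝ) else 0) =
        ∏ j ∈ v, if ⌊(b j : ℝ) ^ (k j + 1) * S i j⌋ = ⌊(b j : ℝ) ^ (k j + 1) * S i' j⌋
          then 1 else 0 :=
      Finset.prod_congr rfl fun j hj => by rw [if_pos hj]
    rw [hbool, ← Finset.prod_sdiff (Finset.mem_powerset.1 hv), hout, hin,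
      Finset.prod_mul_distrib, Finset.prod_neg]
    ring
  simp_rw [gain, hterm, Cq]
  congr 1
  push_cast
  simp_rw [Finset.mul_sum]
  rw [Finset.sum_congr rfl fun i _ => Finset.sum_comm, Finset.sum_comm]

theorem statement6 {d : ℕ} (hd : 1 ≤ d) (b : Fin d → ℕ) (hb : ∀ j, 2 ≤ b j)
    (S : ℕ → Fin d → ℝ) (hS : IsEquidistributed b S)
    (u : Finset (Fin d)) (hu : u.Nonempty) (k : Fin d → ℕ)
    (n : ℕ) (hn : 1 ≤ n) :
    gain b S u k (n * ∏ j ∈ u, b j ^ k j) = gain b S u (fun _ => 0) n := by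
  have hb₀ : ∀ j, 0 < b j := fun j => zero_lt_two.trans_le (hb j)
  have hB : ((∏ j ∈ u, b j ^ k j : ℕ) : ℝ) ≠ 0 :=
    Nat.cast_ne_zero.2 (Finset.prod_pos fun j _ => pow_pos (hb₀ j) _).ne'
  have hn₀ : (n : ℝ) ≠ 0 := Nat.cast_ne_zero.2 (Nat.one_le_iff_ne_zero.1 hn)
  simp_rw [gain_eq_sum_Cq, Cq_mul_prod hb₀ hS u, Nat.cast_mul, mul_left_comm _
    ((∏ j ∈ u, b j ^ k j : ℕ) : ℝ), ← Finset.mul_sum]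
  field_simp

end
end

section
/- Let S be an equidistributed sequence in base b = (b_1,…,b_d) and write G_{u,k}(n) for the gain coefficient of its first n points. For all nonempty subsets v ⊆ u ⊆ {1,…,d}, sup_{n∈ℕ} G_{v,0}(n) ≤ sup_{n∈ℕ} G_{u,0}(n), where 0 denotes the all-zero multi-index on the respective subset. -/
open Finset MeasureTheory

noncomputable section


/-- If every block `[rB, (r+1)B)` hits each attained value exactly once, then each attained value
is taken exactly `r` times before `rB`. -/
lemma card_filter_range_mul_eq {α : Type*} [DecidableEq α] {B : ℕ} {f : ℕ → α}
    (h : ∀ m r, ∃! i, i ∈ Finset.Ico (r * B) ((r + 1) * B) ∧ f i = f m) (m r : ℕ) :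
    #{i ∈ Finset.range (r * B) | f i = f m} = r := by
  induction r with
  | zero => simp
  | succ r ih =>
    have hsplit : ({i ∈ Finset.range ((r + 1) * B) | f i = f m} : Finset ℕ) =
        {i ∈ Finset.range (r * B) | f i = f m} ∪
          {i ∈ Finset.Ico (r * B) ((r + 1) * B) | f i = f m} := by
      rw [← Finset.filter_union]
      congr 1
      ext i
      have : r * B ≤ (r + 1) * B := Nat.mul_le_mul_right _ (Nat.le_succ r)
      simp only [Finset.mem_range, Finset.mem_union, Finset.mem_Ico]
      omega
    have hdisj : Disjoint ({i ∈ Finset.range (r * B) | f i = f m} : Finset ℕ)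
        {i ∈ Finset.Ico (r * B) ((r + 1) * B) | f i = f m} := by
      rw [Finset.disjoint_left]
      intro i hi hi'
      simp only [Finset.mem_filter, Finset.mem_range, Finset.mem_Ico] at hi hi'
      omega
    have hone : #{i ∈ Finset.Ico (r * B) ((r + 1) * B) | f i = f m} = 1 := by
      obtain ⟨i, hi, hu⟩ := h m r
      rw [Finset.card_eq_one]
      refine ⟨i, ?_⟩
      ext i'
      rw [Finset.mem_filter, Finset.mem_singleton]
      exact ⟨fun hi' => hu i' hi', fun e => e ▸ hi⟩
    rw [hsplit, Finset.card_union_of_disjoint hdisj, ih, hone]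

lemma card_filter_range_eq_div {α : Type*} [DecidableEq α] {B : ℕ} (hB : 0 < B) {f : ℕ → α}
    (h : ∀ m r, ∃! i, i ∈ Finset.Ico (r * B) ((r + 1) * B) ∧ f i = f m) (n : ℕ) :
    #{i ∈ Finset.range n | f i = f n} = n / B := by
  rw [← card_filter_range_mul_eq h n (n / B)]
  congr 1
  have hle : n / B * B ≤ n := Nat.div_mul_le_self n B
  have hlt : n < (n / B + 1) * B := by
    rw [mul_comm]
    exact Nat.lt_mul_div_succ n hB
  ext i
  simp only [Finset.mem_filter, Finset.mem_range]
  refine ⟨fun ⟨hi, hf⟩ => ⟨?_, hf⟩, fun ⟨hi, hf⟩ => ⟨hi.trans_le hle, hf⟩⟩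
  by_contra! hi'
  have := (h n (n / B)).unique ⟨Finset.mem_Ico.2 ⟨hi', hi.trans hlt⟩, hf⟩
    ⟨Finset.mem_Ico.2 ⟨hle, hlt⟩, rfl⟩
  omega

/-- `n ^ 2 + r * (B - r)` with `r = n % B`: this is `B` times the number of pairs of coinciding
values among the first `n` terms of a sequence that runs through `B` values in every block. -/
def scaledPairCount (B n : ℕ) : ℝ :=
  (n : ℝ) ^ 2 + ((n % B : ℕ) : ℝ) * ((B : ℝ) - ((n % B : ℕ) : ℝ))

lemma scaledPairCount_succ {B : ℕ} (hB : 0 < B) (n : ℕ) :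
    scaledPairCount B (n + 1) = scaledPairCount B n + B * (2 * ((n / B : ℕ) : ℝ) + 1) := by
  have hn : (B : ℝ) * ((n / B : ℕ) : ℝ) + ((n % B : ℕ) : ℝ) = n := by
    exact_mod_cast Nat.div_add_mod n B
  unfold scaledPairCount
  have hlt := Nat.mod_lt n hB
  rcases Nat.lt_or_ge (n % B + 1) B with hc | hc
  · have : (n + 1) % B = n % B + 1 := by
      rw [Nat.add_mod, Nat.mod_eq_of_lt (a := 1) (by omega), Nat.mod_eq_of_lt hc]
    rw [this]
    push_cast
    linear_combination -2 * hn
  · have hr : n % B + 1 = B := by omega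
    have : (n + 1) % B = 0 := by
      rw [← Nat.mod_add_mod, hr, Nat.mod_self]
    have hr' : ((n % B : ℕ) : ℝ) = B - 1 := by
      rw [eq_sub_iff_add_eq]
      exact_mod_cast hr
    rw [this]
    rw [hr'] at hn ⊢
    push_cast
    linear_combination -2 * hn

lemma scaledPairCount_mul (c B n : ℕ) :
    scaledPairCount (c * B) (c * n) = (c : ℝ) ^ 2 * scaledPairCount B n := by
  unfold scaledPairCount
  rw [Nat.mul_mod_mul_left]
  push_cast
  ring

lemma abs_scaledPairCount_sub_le {B : ℕ} (hB : 0 < B) (n : ℕ) :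
    |scaledPairCount B n - (n : ℝ) ^ 2| ≤ (B : ℝ) ^ 2 := by
  have hlt : ((n % B : ℕ) : ℝ) ≤ B := by exact_mod_cast (Nat.mod_lt n hB).le
  have h0 : (0 : ℝ) ≤ ((n % B : ℕ) : ℝ) := Nat.cast_nonneg _
  unfold scaledPairCount
  rw [add_sub_cancel_left, abs_of_nonneg (mul_nonneg h0 (by linarith))]
  nlinarith

lemma mul_sum_ite_eq_scaledPairCount {α : Type*} [DecidableEq α] {B : ℕ} (hB : 0 < B) {f : ℕ → α}
    (h : ∀ m r, ∃! i, i ∈ Finset.Ico (r * B) ((r + 1) * B) ∧ f i = f m) (n : ℕ) :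
    (B : ℝ) * ∑ i ∈ Finset.range n, ∑ i' ∈ Finset.range n, (if f i = f i' then (1 : ℝ) else 0) =
      scaledPairCount B n := by
  induction n with
  | zero => simp [scaledPairCount]
  | succ n ih =>
    have hcol : ∑ i ∈ Finset.range n, (if f i = f n then (1 : ℝ) else 0) = ((n / B : ℕ) : ℝ) := by
      rw [Finset.sum_boole, card_filter_range_eq_div hB h]
    have hrow : ∑ i ∈ Finset.range n, (if f n = f i then (1 : ℝ) else 0) = ((n / B : ℕ) : ℝ) := by
      simpa only [eq_comm] using hcol
    simp only [Finset.sum_range_succ, Finset.sum_add_distrib, hcol, hrow, if_true]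
    rw [scaledPairCount_succ hB, ← ih]
    ring

lemma IsEquidistributed.mul_sum_ite_floor_eq {d : ℕ} {b : Fin d → ℕ} (hb : ∀ j, 0 < b j)
    {S : ℕ → Fin d → ℝ} (hS : IsEquidistributed b S) (w : Finset (Fin d)) (n : ℕ) :
    ((∏ j ∈ w, b j : ℕ) : ℝ) * ∑ i ∈ Finset.range n, ∑ i' ∈ Finset.range n,
      (if ∀ j ∈ w, ⌊(b j : ℝ) * S i j⌋ = ⌊(b j : ℝ) * S i' j⌋ then (1 : ℝ) else 0) =
      scaledPairCount (∏ j ∈ w, b j) n := by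
  set k : Fin d → ℕ := fun j => if j ∈ w then 1 else 0 with hk
  have hprod : ∏ j, b j ^ k j = ∏ j ∈ w, b j := by
    simp [hk, pow_ite, Finset.prod_ite_mem]
  have hfloor (i j) (hj : j ∉ w) : ⌊(b j : ℝ) ^ k j * S i j⌋ = 0 := by
    have := hS.1 i j
    simpa [hk, hj, Int.floor_eq_zero_iff] using this
  let f : ℕ → Fin d → ℤ := fun i j => ⌊(b j : ℝ) ^ k j * S i j⌋
  have hf (i i') : f i = f i' ↔ ∀ j ∈ w, ⌊(b j : ℝ) * S i j⌋ = ⌊(b j : ℝ) * S i' j⌋ := by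
    rw [funext_iff]
    refine forall_congr' fun j => ?_
    by_cases hj : j ∈ w
    · simp [f, hk, hj]
    · simp [f, hfloor _ j hj, hj]
  have hblock (m r) : ∃! i, i ∈ Finset.Ico (r * ∏ j ∈ w, b j) ((r + 1) * ∏ j ∈ w, b j) ∧
      f i = f m := by
    have := hS.2 r k (f m) fun j => ?_
    · rw [hprod] at this
      simpa only [funext_iff] using this
    · have hx := hS.1 m j
      have hpos : (0 : ℝ) < (b j : ℝ) ^ k j := pow_pos (Nat.cast_pos.2 (hb j)) _
      refine ⟨Int.floor_nonneg.2 (mul_nonneg hpos.le hx.1), Int.floor_lt.2 ?_⟩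
      push_cast
      nlinarith [hx.2]
  rw [← mul_sum_ite_eq_scaledPairCount (Finset.prod_pos fun j _ => hb j) hblock n]
  simp only [hf]

/-- The double sum in the gain coefficient of the first `n` points at resolution zero. -/
def gainNumerator {d : ℕ} (b : Fin d → ℕ) (u : Finset (Fin d)) (n : ℕ) : ℝ :=
  ∑ w ∈ u.powerset, (-1 : ℝ) ^ #(u \ w) * scaledPairCount (∏ j ∈ w, b j) n

lemma IsEquidistributed.gain_zero_eq {d : ℕ} {b : Fin d → ℕ} (hb : ∀ j, 0 < b j)
    {S : ℕ → Fin d → ℝ} (hS : IsEquidistributed b S) (u : Finset (Fin d)) (n : ℕ) :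
    gain b S u (fun _ => 0) n =
      (∏ j ∈ u, ((b j : ℝ) - 1)⁻¹) * (n : ℝ)⁻¹ * gainNumerator b u n := by
  have hterm (i i' : ℕ) : ∏ j ∈ u,
        ((b j : ℝ) *
            (if ⌊(b j : ℝ) ^ (0 + 1) * S i j⌋ = ⌊(b j : ℝ) ^ (0 + 1) * S i' j⌋
              then 1 else 0) -
          (if ⌊(b j : ℝ) ^ 0 * S i j⌋ = ⌊(b j : ℝ) ^ 0 * S i' j⌋ then 1 else 0)) =
      ∑ w ∈ u.powerset, (-1 : ℝ) ^ #(u \ w) * (((∏ j ∈ w, b j : ℕ) : ℝ) *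
        (if ∀ j ∈ w, ⌊(b j : ℝ) * S i j⌋ = ⌊(b j : ℝ) * S i' j⌋ then (1 : ℝ) else 0)) := by
    have hz (i j) : ⌊S i j⌋ = 0 := Int.floor_eq_zero_iff.2 (hS.1 i j)
    simp only [zero_add, pow_one, pow_zero, one_mul, hz, if_true, sub_eq_add_neg]
    rw [Finset.prod_add]
    refine Finset.sum_congr rfl fun w _ => ?_
    rw [Finset.prod_const, Finset.prod_mul_distrib, Finset.prod_ite_zero, Finset.prod_const_one,
      Nat.cast_prod, mul_comm]
    congr!
  unfold gain gainNumerator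
  simp only [hterm]
  congr 1
  simp only [← hS.mul_sum_ite_floor_eq hb, Finset.mul_sum]
  simp_rw [Finset.sum_comm (t := u.powerset)]

lemma gainNumerator_insert_mul {d : ℕ} {b : Fin d → ℕ} {v : Finset (Fin d)} {l : Fin d}
    (hl : l ∉ v) (n : ℕ) :
    gainNumerator b (insert l v) (b l * n) =
      (b l : ℝ) ^ 2 * gainNumerator b v n - gainNumerator b v (b l * n) := by
  unfold gainNumerator
  rw [Finset.sum_powerset_insert hl, Finset.mul_sum, add_comm, sub_eq_add_neg,
    ← Finset.sum_neg_distrib]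
  congr 1 <;> refine Finset.sum_congr rfl fun w hw => ?_
  · have hlw : l ∉ w := fun h => hl (Finset.mem_powerset.1 hw h)
    rw [Finset.prod_insert hlw, scaledPairCount_mul,
      Finset.insert_sdiff_insert, Finset.sdiff_insert_of_notMem hl]
    ring
  · have hlw : l ∉ w := fun h => hl (Finset.mem_powerset.1 hw h)
    rw [Finset.insert_sdiff_of_notMem _ hlw,
      Finset.card_insert_of_notMem (fun h => hl (Finset.mem_sdiff.1 h).1), pow_succ]
    ring

lemma abs_gainNumerator_le {d : ℕ} {b : Fin d → ℕ} (hb : ∀ j, 0 < b j) {u : Finset (Fin d)}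
    (hu : u.Nonempty) (n : ℕ) :
    |gainNumerator b u n| ≤ ∑ w ∈ u.powerset, ((∏ j ∈ w, b j : ℕ) : ℝ) ^ 2 := by
  have hzero : ∑ w ∈ u.powerset, (-1 : ℝ) ^ #(u \ w) = 0 := by
    have := Finset.prod_add (fun _ : Fin d => (1 : ℝ)) (fun _ => -1) u
    simpa [hu.card_ne_zero] using this.symm
  have hN : gainNumerator b u n = ∑ w ∈ u.powerset,
      (-1 : ℝ) ^ #(u \ w) * (scaledPairCount (∏ j ∈ w, b j) n - (n : ℝ) ^ 2) := by
    simp only [mul_sub, Finset.sum_sub_distrib, ← Finset.sum_mul, hzero, zero_mul, sub_zero]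
    rfl
  rw [hN]
  refine (Finset.abs_sum_le_sum_abs _ _).trans (Finset.sum_le_sum fun w _ => ?_)
  rw [abs_mul, abs_neg_one_pow, one_mul]
  exact abs_scaledPairCount_sub_le (Finset.prod_pos fun j _ => hb j) n

lemma IsEquidistributed.bddAbove_range_gain_zero {d : ℕ} {b : Fin d → ℕ} (hb : ∀ j, 0 < b j)
    {S : ℕ → Fin d → ℝ} (hS : IsEquidistributed b S) {u : Finset (Fin d)} (hu : u.Nonempty) :
    BddAbove (Set.range fun n : ℕ+ => gain b S u (fun _ => 0) (n : ℕ)) := by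
  refine ⟨|∏ j ∈ u, ((b j : ℝ) - 1)⁻¹| * 1 *
    ∑ w ∈ u.powerset, ((∏ j ∈ w, b j : ℕ) : ℝ) ^ 2, ?_⟩
  rintro _ ⟨n, rfl⟩
  have hn : (1 : ℝ) ≤ ((n : ℕ) : ℝ) := by exact_mod_cast n.pos
  dsimp only
  rw [hS.gain_zero_eq hb]
  refine (le_abs_self _).trans ?_
  rw [abs_mul, abs_mul, abs_of_nonneg (a := ((n : ℕ) : ℝ)⁻¹) (by positivity)]
  gcongr
  · exact inv_le_one_of_one_le₀ hn
  · exact abs_gainNumerator_le hb hu n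

lemma IsEquidistributed.gain_zero_insert_mul {d : ℕ} {b : Fin d → ℕ} (hb : ∀ j, 2 ≤ b j)
    {S : ℕ → Fin d → ℝ} (hS : IsEquidistributed b S) {v : Finset (Fin d)} {l : Fin d}
    (hl : l ∉ v) {n : ℕ} (hn : 0 < n) :
    ((b l : ℝ) - 1) * gain b S (insert l v) (fun _ => 0) (b l * n) =
      b l * gain b S v (fun _ => 0) n - gain b S v (fun _ => 0) (b l * n) := by
  have hb' (j) : 0 < b j := by linarith [hb j]
  have h2 : (2 : ℝ) ≤ b l := by exact_mod_cast hb l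
  have hb1 : (b l : ℝ) - 1 ≠ 0 := by linarith
  have hb0 : (b l : ℝ) ≠ 0 := by linarith
  have hn0 : (n : ℝ) ≠ 0 := by exact_mod_cast hn.ne'
  simp only [hS.gain_zero_eq hb', gainNumerator_insert_mul hl, Finset.prod_insert hl]
  push_cast
  field_simp

lemma IsEquidistributed.iSup_gain_zero_le_insert {d : ℕ} {b : Fin d → ℕ} (hb : ∀ j, 2 ≤ b j)
    {S : ℕ → Fin d → ℝ} (hS : IsEquidistributed b S) {v : Finset (Fin d)} (hv : v.Nonempty)
    {l : Fin d} (hl : l ∉ v) :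
    (⨆ n : ℕ+, gain b S v (fun _ => 0) (n : ℕ)) ≤
      ⨆ n : ℕ+, gain b S (insert l v) (fun _ => 0) (n : ℕ) := by
  have hb' (j) : 0 < b j := by linarith [hb j]
  have h2 : (2 : ℝ) ≤ b l := by exact_mod_cast hb l
  have hbv := hS.bddAbove_range_gain_zero hb' hv
  have hbu := hS.bddAbove_range_gain_zero hb' (Finset.insert_nonempty l v)
  set M := ⨆ n : ℕ+, gain b S v (fun _ => 0) (n : ℕ)
  set M' := ⨆ n : ℕ+, gain b S (insert l v) (fun _ => 0) (n : ℕ)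
  have key : M ≤ (((b l : ℝ) - 1) * M' + M) / b l := by
    refine ciSup_le fun n => ?_
    have hmul := hS.gain_zero_insert_mul hb hl n.pos
    have hv' : gain b S v (fun _ => 0) (b l * n) ≤ M := le_ciSup hbv (Nat.toPNat (b l) (hb' l) * n)
    have hu' : gain b S (insert l v) (fun _ => 0) (b l * n) ≤ M' :=
      le_ciSup hbu (Nat.toPNat (b l) (hb' l) * n)
    rw [le_div_iff₀ (by linarith)]
    nlinarith
  rw [le_div_iff₀ (by linarith)] at key
  nlinarith

theorem statement7 {d : ℕ} (hd : 1 ≤ d) (b : Fin d → ℕ) (hb : ∀ j, 2 ≤ b j)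
    (S : ℕ → Fin d → ℝ) (hS : IsEquidistributed b S)
    (u : Finset (Fin d)) (hu : u.Nonempty)
    (v : Finset (Fin d)) (hv : v.Nonempty) (hvu : v ⊆ u) :
    (⨆ n : ℕ+, gain b S v (fun _ => 0) (n : ℕ)) ≤
      ⨆ n : ℕ+, gain b S u (fun _ => 0) (n : ℕ) := by
  rw [← Finset.union_sdiff_of_subset hvu]
  induction u \ v using Finset.induction_on with
  | empty => rw [Finset.union_empty]
  | insert l t _ ih =>
    rw [Finset.union_insert]
    by_cases hl : l ∈ v ∪ t
    · rwa [Finset.insert_eq_of_mem hl]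
    · exact ih.trans (hS.iSup_gain_zero_le_insert hb (hv.mono Finset.subset_union_left) hl)

end
end

section
/- Let S be an equidistributed sequence in base b = (b_1,…,b_d) and write G_{u,k}(n) for the gain coefficient of its first n points. Fix a nonempty u ⊆ {1,…,d} and let j_m ∈ u be an index minimizing b_j over j ∈ u. Then for every k ∈ ℕ_0^{|u|}, sup_{n∈ℕ} G_{u,0}(n) = sup_{n∈ℕ} G_{u,k}(n), and this common supremum is at most ∏_{j∈u∖{j_m}} b_j/(b_j−1) (with the empty product equal to 1). -/
open Finset MeasureTheory

noncomputable section


section CellCounting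

theorem sum_pairs_eq_sum_range {α : Type*} [DecidableEq α] (l : ℕ → α) (n : ℕ) :
    (∑ i ∈ range n, ∑ i' ∈ range n, if l i = l i' then (1 : ℝ) else 0) =
      ∑ i ∈ range n, (2 * (((range i).filter fun i' => l i' = l i).card : ℝ) + 1) := by
  induction n with
  | zero => simp
  | succ n ih =>
    have h : ∀ i, (∑ i' ∈ range (n + 1), if l i = l i' then (1 : ℝ) else 0) =
        (∑ i' ∈ range n, if l i = l i' then (1 : ℝ) else 0) + if l i = l n then 1 else 0 :=
      fun i => sum_range_succ _ _
    simp_rw [h]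
    rw [sum_add_distrib, sum_range_succ, sum_range_succ, sum_range_succ, ih]
    have h1 : (∑ i' ∈ range n, if l n = l i' then (1 : ℝ) else 0) =
        ((range n).filter fun i' => l i' = l n).card := by
      simp [eq_comm]
    have h2 : (∑ i ∈ range n, if l i = l n then (1 : ℝ) else 0) =
        ((range n).filter fun i' => l i' = l n).card := by
      simp
    rw [h1, h2]
    simp only [if_true]
    ring

/-- Label of the elementary `κ`-interval containing the point `S i`. -/
def cell {d : ℕ} (b : Fin d → ℕ) (S : ℕ → Fin d → ℝ) (κ : Fin d → ℕ) (i : ℕ) (j : Fin d) : ℤ :=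
  ⌊(b j : ℝ) ^ κ j * S i j⌋

variable {d : ℕ} {b : Fin d → ℕ} {S : ℕ → Fin d → ℝ}

theorem IsEquidistributed.cell_nonneg (hS : IsEquidistributed b S) (κ : Fin d → ℕ) (i : ℕ)
    (j : Fin d) : 0 ≤ cell b S κ i j :=
  Int.floor_nonneg.2 (mul_nonneg (by positivity) (hS.1 i j).1)

theorem IsEquidistributed.cell_lt (hb : ∀ j, 0 < b j) (hS : IsEquidistributed b S)
    (κ : Fin d → ℕ) (i : ℕ) (j : Fin d) : cell b S κ i j < (b j : ℤ) ^ κ j := by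
  rw [cell, Int.floor_lt]
  have h : (0 : ℝ) < (b j : ℝ) ^ κ j := pow_pos (by exact_mod_cast hb j) _
  push_cast
  nlinarith [(hS.1 i j).2]

theorem IsEquidistributed.card_filter_cell_eq (hb : ∀ j, 0 < b j) (hS : IsEquidistributed b S)
    (κ : Fin d → ℕ) (n : ℕ) :
    ((range n).filter fun i' => cell b S κ i' = cell b S κ n).card =
      n / ∏ j, b j ^ κ j := by
  have key := fun r => hS.2 r κ (cell b S κ n)
    fun j => ⟨hS.cell_nonneg κ n j, hS.cell_lt hb κ n j⟩
  have hM : 0 < ∏ j, b j ^ κ j := prod_pos fun j _ => pow_pos (hb j) _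
  generalize (∏ j, b j ^ κ j) = M at key hM ⊢
  have huniq : ∀ i i', cell b S κ i = cell b S κ n → cell b S κ i' = cell b S κ n →
      i / M = i' / M → i = i' := by
    intro i i' hi hi' h
    have mem : ∀ x, x ∈ Finset.Ico (x / M * M) ((x / M + 1) * M) := fun x =>
      mem_Ico.2 ⟨Nat.div_mul_le_self x M, Nat.lt_mul_of_div_lt (Nat.lt_succ_self _) hM⟩
    exact (key (i / M)).unique ⟨mem i, congrFun hi⟩ ⟨h ▸ mem i', congrFun hi'⟩
  rw [← card_range (n / M)]
  refine card_bij (fun i _ => i / M) ?_ ?_ ?_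
  · intro i hi
    rw [mem_filter, mem_range] at hi
    rw [mem_range]
    refine lt_of_le_of_ne (Nat.div_le_div_right hi.1.le) fun h => ?_
    exact hi.1.ne (huniq i n hi.2 rfl h)
  · intro i hi i' hi' h
    exact huniq i i' (mem_filter.1 hi).2 (mem_filter.1 hi').2 h
  · intro r hr
    rw [mem_range] at hr
    obtain ⟨i, ⟨hi, hc⟩, -⟩ := key r
    rw [mem_Ico] at hi
    have hn : (r + 1) * M ≤ n := (Nat.le_div_iff_mul_le hM).1 hr
    exact ⟨i, mem_filter.2 ⟨mem_range.2 (hi.2.trans_le hn), funext hc⟩,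
      Nat.div_eq_of_lt_le hi.1 hi.2⟩

theorem IsEquidistributed.sum_pairs_prod_eq (hb : ∀ j, 0 < b j) (hS : IsEquidistributed b S)
    {u v : Finset (Fin d)} (hv : v ⊆ u) (k : Fin d → ℕ) (n : ℕ) :
    (∑ i ∈ range n, ∑ i' ∈ range n,
      (∏ j ∈ v, if ⌊(b j : ℝ) ^ (k j + 1) * S i j⌋ = ⌊(b j : ℝ) ^ (k j + 1) * S i' j⌋
        then (1 : ℝ) else 0) *
      ∏ j ∈ u \ v, if ⌊(b j : ℝ) ^ k j * S i j⌋ = ⌊(b j : ℝ) ^ k j * S i' j⌋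
        then (1 : ℝ) else 0) =
      ∑ i ∈ range n, (2 * ((i / ((∏ j ∈ u, b j ^ k j) * ∏ j ∈ v, b j) : ℕ) : ℝ) + 1) := by
  let κ : Fin d → ℕ := fun j => if j ∈ v then k j + 1 else if j ∈ u then k j else 0
  have hM : (∏ j, b j ^ κ j) = (∏ j ∈ u, b j ^ k j) * ∏ j ∈ v, b j := by
    rw [← prod_sdiff hv, mul_assoc, ← prod_mul_distrib,
      ← prod_subset (subset_univ u) (fun j _ hj => ?_), ← prod_sdiff hv]
    · congr 1
      · refine prod_congr rfl fun j hj => ?_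
        rw [mem_sdiff] at hj
        simp [κ, hj.1, hj.2]
      · refine prod_congr rfl fun j hj => ?_
        simp [κ, hj, pow_succ]
    · have hjv : j ∉ v := fun h => hj (hv h)
      simp [κ, hj, hjv]
  have hcell : ∀ i i', ((∏ j ∈ v,
        if ⌊(b j : ℝ) ^ (k j + 1) * S i j⌋ = ⌊(b j : ℝ) ^ (k j + 1) * S i' j⌋
        then (1 : ℝ) else 0) *
      ∏ j ∈ u \ v, if ⌊(b j : ℝ) ^ k j * S i j⌋ = ⌊(b j : ℝ) ^ k j * S i' j⌋
        then (1 : ℝ) else 0) = if cell b S κ i = cell b S κ i' then 1 else 0 := by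
    intro i i'
    have hiff : ((∀ j ∈ v,
          ⌊(b j : ℝ) ^ (k j + 1) * S i j⌋ = ⌊(b j : ℝ) ^ (k j + 1) * S i' j⌋) ∧
        ∀ j ∈ u \ v, ⌊(b j : ℝ) ^ k j * S i j⌋ = ⌊(b j : ℝ) ^ k j * S i' j⌋) ↔
        cell b S κ i = cell b S κ i' := by
      constructor
      · rintro ⟨h1, h2⟩
        funext j
        by_cases hjv : j ∈ v
        · simpa [cell, κ, hjv] using h1 j hjv
        by_cases hju : j ∈ u
        · simpa [cell, κ, hjv, hju] using h2 j (mem_sdiff.2 ⟨hju, hjv⟩)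
        · have h0 : ∀ x, ⌊S x j⌋ = 0 := fun x => Int.floor_eq_zero_iff.2 (hS.1 x j)
          simp [cell, κ, hjv, hju, h0]
      · intro h
        refine ⟨fun j hj => ?_, fun j hj => ?_⟩
        · simpa [cell, κ, hj] using congrFun h j
        · rw [mem_sdiff] at hj
          simpa [cell, κ, hj.1, hj.2] using congrFun h j
    rw [prod_ite_zero, prod_ite_zero, prod_const_one, prod_const_one]
    by_cases hc : cell b S κ i = cell b S κ i'
    · rw [if_pos hc, if_pos (hiff.2 hc).1, if_pos (hiff.2 hc).2, mul_one]
    · rw [if_neg hc]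
      rw [← hiff, not_and_or] at hc
      rcases hc with h | h <;> simp only [if_neg h, zero_mul, mul_zero]
  simp_rw [hcell]
  rw [sum_pairs_eq_sum_range]
  simp_rw [hS.card_filter_cell_eq hb, hM]

/-- Contribution of the point with index `m` to the unnormalized gain coefficient at
resolution `0`. -/
def gainIncrement (b : Fin d → ℕ) (u : Finset (Fin d)) (m : ℕ) : ℝ :=
  ∑ v ∈ u.powerset, (∏ j ∈ v, (b j : ℝ)) * (∏ _j ∈ u \ v, (-1)) *
    (2 * ((m / ∏ j ∈ v, b j : ℕ) : ℝ) + 1)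

theorem IsEquidistributed.sum_pairs_prod_sub_eq (hb : ∀ j, 0 < b j)
    (hS : IsEquidistributed b S) (u : Finset (Fin d)) (k : Fin d → ℕ) (n : ℕ) :
    (∑ i ∈ range n, ∑ i' ∈ range n, ∏ j ∈ u,
      ((b j : ℝ) *
          (if ⌊(b j : ℝ) ^ (k j + 1) * S i j⌋ = ⌊(b j : ℝ) ^ (k j + 1) * S i' j⌋
            then 1 else 0) -
        (if ⌊(b j : ℝ) ^ k j * S i j⌋ = ⌊(b j : ℝ) ^ k j * S i' j⌋ then 1 else 0))) =
      ∑ i ∈ range n, gainIncrement b u (i / ∏ j ∈ u, b j ^ k j) := by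
  simp_rw [sub_eq_add_neg, prod_add, gainIncrement]
  rw [sum_comm (s := range n) (t := u.powerset)]
  simp_rw [sum_comm (s := range n) (t := u.powerset)]
  refine sum_congr rfl fun v hv => ?_
  simp_rw [Nat.div_div_eq_div_mul]
  rw [← mul_sum, ← hS.sum_pairs_prod_eq hb (mem_powerset.1 hv), mul_sum]
  refine sum_congr rfl fun i _ => ?_
  rw [mul_sum]
  refine sum_congr rfl fun i' _ => ?_
  rw [prod_mul_distrib, prod_neg, prod_const]
  ring

theorem IsEquidistributed.gain_eq (hb : ∀ j, 0 < b j) (hS : IsEquidistributed b S)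
    (u : Finset (Fin d)) (k : Fin d → ℕ) (n : ℕ) :
    gain b S u k n = (∏ j ∈ u, ((b j : ℝ) - 1)⁻¹) * (n : ℝ)⁻¹ *
      ∑ i ∈ range n, gainIncrement b u (i / ∏ j ∈ u, b j ^ k j) := by
  rw [gain, hS.sum_pairs_prod_sub_eq hb]

theorem sum_range_div (w : ℕ → ℝ) (K q : ℕ) :
    ∀ r ≤ K, ∑ i ∈ range (q * K + r), w (i / K) = K * ∑ m ∈ range q, w m + r * w q := by
  have step : ∀ q, ∑ i ∈ range (q * K), w (i / K) = K * ∑ m ∈ range q, w m →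
      ∀ r ≤ K, ∑ i ∈ range (q * K + r), w (i / K) = K * ∑ m ∈ range q, w m + r * w q := by
    intro q hq r hr
    have hw : ∑ x ∈ range r, w ((q * K + x) / K) = ∑ x ∈ range r, w q := by
      refine sum_congr rfl fun x hx => ?_
      rw [mem_range] at hx
      rw [Nat.div_eq_of_lt_le (k := q) (by omega) (by rw [Nat.succ_mul]; omega)]
    rw [sum_range_add, hq, hw]
    simp
  refine step q ?_
  induction q with
  | zero => simp
  | succ q ih =>
    rw [Nat.succ_mul, step q ih K le_rfl, sum_range_succ]
    ring

theorem sum_range_div_le {w : ℕ → ℝ} {s : ℝ} (h : ∀ m, ∑ i ∈ range m, w i ≤ s * m)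
    {K : ℕ} (hK : 0 < K) (n : ℕ) : ∑ i ∈ range n, w (i / K) ≤ s * n := by
  have hr : n % K ≤ K := (Nat.mod_lt n hK).le
  have hn : n / K * K + n % K = n := Nat.div_add_mod' n K
  generalize n / K = q at hn
  generalize n % K = r at hn hr
  subst hn
  rw [sum_range_div w K q r hr]
  have h1 := h q
  have h2 := h (q + 1)
  rw [sum_range_succ] at h2
  push_cast at h2 ⊢
  have hr' : (r : ℝ) ≤ K := by exact_mod_cast hr
  have := mul_le_mul_of_nonneg_left h1 (sub_nonneg.2 hr')
  have := mul_le_mul_of_nonneg_left h2 (Nat.cast_nonneg (α := ℝ) r)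
  linarith

theorem mul_ite_sub_one_eq_sum {B : ℕ} (hB : 0 < B) {p q : ℤ} (hp : 0 ≤ p) (hpB : p < B)
    (hq : 0 ≤ q) (hqB : q < B) :
    ((B : ℝ) * (if p = q then 1 else 0) - 1) =
      ∑ c ∈ range B, (B : ℝ)⁻¹ * (((B : ℝ) * (if p = c then 1 else 0) - 1) *
        ((B : ℝ) * (if q = c then 1 else 0) - 1)) := by
  lift p to ℕ using hp
  lift q to ℕ using hq
  have hp' : p ∈ range B := mem_range.2 (by exact_mod_cast hpB)
  have hq' : q ∈ range B := mem_range.2 (by exact_mod_cast hqB)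
  have hB' : (B : ℝ) ≠ 0 := by positivity
  have h : ∀ c : ℕ, (B : ℝ)⁻¹ * (((B : ℝ) * (if (p : ℤ) = c then 1 else 0) - 1) *
        ((B : ℝ) * (if (q : ℤ) = c then 1 else 0) - 1)) =
      (if p = c then (B : ℝ) * (if p = q then 1 else 0) - 1 else 0) -
        (if q = c then 1 else 0) + (B : ℝ)⁻¹ := by
    intro c
    by_cases h1 : p = c <;> by_cases h2 : q = c
    · subst h1; subst h2; simp; field_simp; ring
    · subst h1; simp [h2, Ne.symm h2]; field_simp; ring
    · subst h2; simp [h1]; field_simp; ring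
    · simp [h1, h2]
  simp_rw [h]
  rw [sum_add_distrib, sum_sub_distrib, sum_ite_eq, sum_ite_eq, if_pos hp', if_pos hq']
  simp [hB']

theorem IsEquidistributed.sum_pairs_prod_nonneg (hb : ∀ j, 0 < b j)
    (hS : IsEquidistributed b S) (t : Finset (Fin d)) (n : ℕ) :
    0 ≤ ∑ i ∈ range n, ∑ i' ∈ range n, ∏ j ∈ t,
      ((b j : ℝ) * (if ⌊(b j : ℝ) * S i j⌋ = ⌊(b j : ℝ) * S i' j⌋ then 1 else 0) - 1) := by
  have hc : ∀ i j, 0 ≤ ⌊(b j : ℝ) * S i j⌋ ∧ ⌊(b j : ℝ) * S i j⌋ < b j := fun i j => by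
    simpa [cell] using And.intro (hS.cell_nonneg (fun _ => 1) i j) (hS.cell_lt hb (fun _ => 1) i j)
  let e : ℕ → Fin d → ℕ → ℝ := fun i j c =>
    (b j : ℝ) * (if ⌊(b j : ℝ) * S i j⌋ = c then 1 else 0) - 1
  have h : ∀ i i', (∏ j ∈ t, ((b j : ℝ) *
      (if ⌊(b j : ℝ) * S i j⌋ = ⌊(b j : ℝ) * S i' j⌋ then 1 else 0) - 1)) =
      ∑ c ∈ t.pi fun j => range (b j), (∏ j ∈ t, (b j : ℝ)⁻¹) *
        ((∏ x ∈ t.attach, e i x.1 (c x.1 x.2)) * ∏ x ∈ t.attach, e i' x.1 (c x.1 x.2)) := by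
    intro i i'
    rw [prod_congr rfl fun j _ => mul_ite_sub_one_eq_sum (hb j) (hc i j).1 (hc i j).2
      (hc i' j).1 (hc i' j).2, prod_sum]
    refine sum_congr rfl fun c _ => ?_
    rw [prod_mul_distrib, prod_mul_distrib, prod_attach t fun j => (b j : ℝ)⁻¹]
  simp_rw [h]
  simp_rw [sum_comm (s := range n) (t := t.pi fun j => range (b j)), ← mul_sum, ← sum_mul]
  exact mul_nonneg (prod_nonneg fun j _ => by positivity)
    (sum_nonneg fun c _ => mul_self_nonneg _)

theorem IsEquidistributed.sum_gainIncrement_le (hb : ∀ j, 0 < b j)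
    (hS : IsEquidistributed b S) {u : Finset (Fin d)} {m : Fin d} (hm : m ∈ u) (n : ℕ) :
    ∑ i ∈ range n, gainIncrement b u i ≤
      ((b m : ℝ) - 1) * (∏ j ∈ u.erase m, (b j : ℝ)) * n := by
  let χ : Fin d → ℕ → ℕ → ℝ := fun j i i' =>
    if ⌊(b j : ℝ) * S i j⌋ = ⌊(b j : ℝ) * S i' j⌋ then 1 else 0
  let T : (ℕ → ℕ → ℝ) → ℝ := fun f => ∑ i ∈ range n, ∑ i' ∈ range n, f i i'
  have hχ : ∀ v : Finset (Fin d), T (fun i i' => ∏ j ∈ v, χ j i i') =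
      ∑ i ∈ range n, (2 * ((i / ∏ j ∈ v, b j : ℕ) : ℝ) + 1) := fun v => by
    simpa using hS.sum_pairs_prod_eq hb (Subset.refl v) (fun _ => 0) n
  have hgain : ∑ i ∈ range n, gainIncrement b u i =
      T fun i i' => ∏ j ∈ u, ((b j : ℝ) * χ j i i' - 1) := by
    have h0 : ∀ x j, ⌊S x j⌋ = 0 := fun x j => Int.floor_eq_zero_iff.2 (hS.1 x j)
    simpa [h0, T, χ] using (hS.sum_pairs_prod_sub_eq hb u (fun _ => 0) n).symm
  have hdom : (T fun i i' => ∏ j ∈ u, ((b j : ℝ) * χ j i i' - 1)) ≤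
      T fun i i' => ((b m : ℝ) * χ m i i' - 1) * ∏ j ∈ u.erase m, ((b j : ℝ) * χ j i i') := by
    have hexp : (T fun i i' => ((b m : ℝ) * χ m i i' - 1) *
        ∏ j ∈ u.erase m, ((b j : ℝ) * χ j i i')) = ∑ t ∈ (u.erase m).powerset,
          T fun i i' => ∏ j ∈ insert m t, ((b j : ℝ) * χ j i i' - 1) := by
      have h : ∀ i i', ((b m : ℝ) * χ m i i' - 1) * ∏ j ∈ u.erase m, ((b j : ℝ) * χ j i i') =
          ∑ t ∈ (u.erase m).powerset, ∏ j ∈ insert m t, ((b j : ℝ) * χ j i i' - 1) := by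
        intro i i'
        have := prod_add_one (u.erase m) (f := fun j => (b j : ℝ) * χ j i i' - 1)
        simp only [sub_add_cancel] at this
        rw [this, mul_sum]
        refine sum_congr rfl fun t ht => ?_
        rw [prod_insert fun hmt => notMem_erase m u (mem_powerset.1 ht hmt)]
      simp only [T, h]
      simp_rw [sum_comm (s := range n) (t := (u.erase m).powerset)]
    rw [hexp]
    have := single_le_sum (s := (u.erase m).powerset)
      (f := fun t => T fun i i' => ∏ j ∈ insert m t, ((b j : ℝ) * χ j i i' - 1))
      (fun t _ => hS.sum_pairs_prod_nonneg hb _ n) (mem_powerset_self _)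
    simpa only [insert_erase hm] using this
  have hsplit : (T fun i i' => ((b m : ℝ) * χ m i i' - 1) *
      ∏ j ∈ u.erase m, ((b j : ℝ) * χ j i i')) = (∏ j ∈ u.erase m, (b j : ℝ)) *
        (b m * T (fun i i' => ∏ j ∈ u, χ j i i') -
          T fun i i' => ∏ j ∈ u.erase m, χ j i i') := by
    simp only [T, mul_sum, ← sum_sub_distrib]
    refine sum_congr rfl fun i _ => sum_congr rfl fun i' _ => ?_
    rw [prod_mul_distrib, ← mul_prod_erase u (fun j => χ j i i') hm]
    ring
  rw [hgain, mul_comm ((b m : ℝ) - 1), mul_assoc]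
  refine hdom.trans ?_
  rw [hsplit, hχ, hχ, mul_sum, ← sum_sub_distrib]
  refine mul_le_mul_of_nonneg_left ?_ (by positivity)
  have hterm : ∀ i ∈ range n, (b m : ℝ) * (2 * ((i / ∏ j ∈ u, b j : ℕ) : ℝ) + 1) -
      (2 * ((i / ∏ j ∈ u.erase m, b j : ℕ) : ℝ) + 1) ≤ (b m : ℝ) - 1 := by
    intro i _
    have h : b m * (i / ∏ j ∈ u, b j) ≤ i / ∏ j ∈ u.erase m, b j := by
      rw [← mul_prod_erase u b hm, mul_comm (b m) (∏ j ∈ u.erase m, b j),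
        ← Nat.div_div_eq_div_mul]
      exact Nat.mul_div_le _ _
    have h' : (b m : ℝ) * ((i / ∏ j ∈ u, b j : ℕ) : ℝ) ≤
        ((i / ∏ j ∈ u.erase m, b j : ℕ) : ℝ) := by exact_mod_cast h
    linarith
  refine (sum_le_sum hterm).trans_eq ?_
  rw [sum_const, card_range, nsmul_eq_mul, mul_comm]

end CellCounting

theorem statement8 {d : ℕ} (hd : 1 ≤ d) (b : Fin d → ℕ) (hb : ∀ j, 2 ≤ b j)
    (S : ℕ → Fin d → ℝ) (hS : IsEquidistributed b S)
    (u : Finset (Fin d)) (hu : u.Nonempty)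
    (jm : Fin d) (hjm : jm ∈ u) (hmin : ∀ j ∈ u, b jm ≤ b j)
    (k : Fin d → ℕ) :
    (⨆ n : ℕ+, gain b S u (fun _ => 0) (n : ℕ)) = (⨆ n : ℕ+, gain b S u k (n : ℕ)) ∧
      (⨆ n : ℕ+, gain b S u k (n : ℕ)) ≤
        ∏ j ∈ u.erase jm, (b j : ℝ) / ((b j : ℝ) - 1) := by
  have hb0 : ∀ j, 0 < b j := fun j => two_pos.trans_le (hb j)
  have hb1 : ∀ j, (0 : ℝ) < (b j : ℝ) - 1 := fun j => by
    have : (2 : ℝ) ≤ b j := by exact_mod_cast hb j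
    linarith
  have hP : 0 < ∏ j ∈ u, ((b j : ℝ) - 1)⁻¹ := prod_pos fun j _ => inv_pos.2 (hb1 j)
  have hK : ∀ k : Fin d → ℕ, 0 < ∏ j ∈ u, b j ^ k j :=
    fun k => prod_pos fun j _ => pow_pos (hb0 j) _
  have transfer : ∀ s : ℝ, (∀ n : ℕ+, gain b S u (fun _ => 0) n ≤ s) →
      ∀ (k : Fin d → ℕ) (n : ℕ+), gain b S u k n ≤ s := by
    intro s h k n
    have h' : ∀ m : ℕ, ∑ i ∈ range m, gainIncrement b u i ≤
        s / (∏ j ∈ u, ((b j : ℝ) - 1)⁻¹) * m := by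
      intro m
      rcases Nat.eq_zero_or_pos m with rfl | hm
      · simp
      have := h ⟨m, hm⟩
      rw [hS.gain_eq hb0] at this
      simp only [pow_zero, prod_const_one, Nat.div_one, PNat.mk_coe] at this
      have hm' : (0 : ℝ) < m := by exact_mod_cast hm
      rw [mul_right_comm, ← div_eq_mul_inv, div_le_iff₀ hm'] at this
      rw [div_mul_eq_mul_div, le_div_iff₀ hP]
      linarith
    have hn : (0 : ℝ) < (n : ℕ) := by exact_mod_cast n.pos
    have := sum_range_div_le h' (hK k) n
    rw [hS.gain_eq hb0, mul_right_comm, ← div_eq_mul_inv, div_le_iff₀ hn]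
    rw [div_mul_eq_mul_div, le_div_iff₀ hP] at this
    linarith
  have bound0 : ∀ n : ℕ+, gain b S u (fun _ => 0) n ≤
      ∏ j ∈ u.erase jm, (b j : ℝ) / ((b j : ℝ) - 1) := by
    intro n
    have hn : (0 : ℝ) < (n : ℕ) := by exact_mod_cast n.pos
    rw [hS.gain_eq hb0]
    simp only [pow_zero, prod_const_one, Nat.div_one]
    refine (mul_le_mul_of_nonneg_left (hS.sum_gainIncrement_le hb0 hjm n)
      (by positivity)).trans_eq ?_
    simp_rw [div_eq_mul_inv]
    rw [prod_mul_distrib, ← mul_prod_erase u _ hjm]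
    have := (hb1 jm).ne'
    field_simp
  have bound := transfer _ bound0
  have bdd : ∀ k, BddAbove (Set.range fun n : ℕ+ => gain b S u k (n : ℕ)) :=
    fun k => ⟨_, Set.forall_mem_range.2 (bound k)⟩
  refine ⟨le_antisymm (ciSup_le fun n => ?_)
    (ciSup_le (transfer _ (fun n => le_ciSup (bdd fun _ => 0) n) k)), ciSup_le (bound k)⟩
  refine le_ciSup_of_le (bdd k) ⟨n * ∏ j ∈ u, b j ^ k j, mul_pos n.pos (hK k)⟩ (le_of_eq ?_)
  rw [PNat.mk_coe, hS.gain_eq hb0, hS.gain_eq hb0]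
  simp only [pow_zero, prod_const_one, Nat.div_one]
  have := sum_range_div (gainIncrement b u) (∏ j ∈ u, b j ^ k j) n 0 (Nat.zero_le _)
  rw [add_zero] at this
  rw [this]
  have hK' : ((∏ j ∈ u, b j ^ k j : ℕ) : ℝ) ≠ 0 := by exact_mod_cast (hK k).ne'
  have hn : ((n : ℕ) : ℝ) ≠ 0 := by exact_mod_cast n.pos.ne'
  rw [Nat.cast_mul]
  field_simp
  simp [mul_assoc]

end
end
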